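/- Let m ≥ 1 and let v be a λ'-eigenfunction of −Δ_{m+1} with λ' ∉ {1,3}. Then the function u on K_m defined by u(n) = v(5n) is a nonzero R(λ')-eigenfunction of −Δ_m, and v equals the λ'-extension of u. -/

import Mathlib

open scoped BigOperators

noncomputable section

namespace VNLE

/-- `N_m = 2·5^m`, the number of points on the circle at level `m`. -/
def Nm (m : ℕ) : ℕ := 2 * 5 ^ m

/-- The partner of a vertex `n` of `K_m`: writing the representative `v` of `n`
(taking `v = 2·5^m` when `n = 0`) as `v = 5^k·a` with `5 ∤ a`, the partner is
`n + 5^k` if `a ≡ 1` or `3 (mod 5)`, and `n - 5^k` if `a ≡ 2` or `4 (mod 5)`.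
This realizes the identifications `5^k(1+5j) ∼ 5^k(2+5j)` and
`5^k(3+5j) ∼ 5^k(4+5j)` in `ℤ/(2·5^m)ℤ`. -/
def partner (m : ℕ) (n : ZMod (Nm m)) : ZMod (Nm m) :=
  let v : ℕ := if n.val = 0 then Nm m else n.val
  let k : ℕ := padicValNat 5 v
  if (v / 5 ^ k) % 5 = 1 ∨ (v / 5 ^ k) % 5 = 3 then n + ((5 ^ k : ℕ) : ZMod (Nm m))
  else n - ((5 ^ k : ℕ) : ZMod (Nm m))

/-- A function on `K_m`: a map on `ℤ/N_mℤ` constant on the identified pairs. -/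
def IsKFun (m : ℕ) (u : ZMod (Nm m) → ℝ) : Prop := ∀ n, u (partner m n) = u n

/-- The graph Laplacian `−Δ_m`. -/
def lap (m : ℕ) (u : ZMod (Nm m) → ℝ) : ZMod (Nm m) → ℝ := fun n =>
  4 * u n - u (n + 1) - u (n - 1) - u (partner m n + 1) - u (partner m n - 1)

/-- `u` is a `λ`-eigenfunction of `−Δ_m`. -/
def IsEigen (m : ℕ) (lam : ℝ) (u : ZMod (Nm m) → ℝ) : Prop :=
  IsKFun m u ∧ u ≠ 0 ∧ ∀ n, lap m u n = lam * u n

/-- The spectral decimation renormalization polynomial `R(x) = x(3−x)(5−x)`. -/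
def R (x : ℝ) : ℝ := x * (3 - x) * (5 - x)

/-- The `λ'`-extension of a function on `K_m` to a function on `K_{m+1}`. -/
def extFun (m : ℕ) (lam' : ℝ) (u : ZMod (Nm m) → ℝ) : ZMod (Nm (m + 1)) → ℝ := fun x =>
  let n : ZMod (Nm m) := ((x.val / 5 : ℕ) : ZMod (Nm m))
  if x.val % 5 = 0 then u n
  else if x.val % 5 = 1 ∨ x.val % 5 = 2 then
    ((2 - lam') * u n + u (n + 1)) / ((1 - lam') * (3 - lam'))
  else
    (u n + (2 - lam') * u (n + 1)) / ((1 - lam') * (3 - lam'))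

/-- Restriction of a function on `K_{m+1}` to the old vertices, giving a function on `K_m`. -/
def down (m : ℕ) (v : ZMod (Nm (m + 1)) → ℝ) : ZMod (Nm m) → ℝ := fun n =>
  v (((5 * n.val : ℕ) : ZMod (Nm (m + 1))))

/-- The Laplacian `−Δ_m` as a linear map. -/
def lapL (m : ℕ) : (ZMod (Nm m) → ℝ) →ₗ[ℝ] (ZMod (Nm m) → ℝ) where
  toFun := lap m
  map_add' u v := by funext n; simp only [lap, Pi.add_apply]; ring
  map_smul' c u := by funext n; simp only [lap, Pi.smul_apply, smul_eq_mul, RingHom.id_apply]; ring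

/-- The subspace of functions on `K_m` (maps constant on identified pairs). -/
def KFunSub (m : ℕ) : Submodule ℝ (ZMod (Nm m) → ℝ) where
  carrier := {u | IsKFun m u}
  add_mem' := by
    intro u v hu hv n
    simp only [Pi.add_apply, hu n, hv n]
  zero_mem' := fun _ => rfl
  smul_mem' := by
    intro c u hu n
    simp only [Pi.smul_apply, hu n]

/-- The `λ`-eigenspace of `−Δ_m` inside the space of functions on `K_m`. -/
def eigensp (m : ℕ) (lam : ℝ) : Submodule ℝ (ZMod (Nm m) → ℝ) :=
  LinearMap.ker (lapL m - lam • LinearMap.id) ⊓ KFunSub m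

/-- `c = (8 − √19)/3`, the smaller critical point of `R`. -/
def cpt : ℝ := (8 - Real.sqrt 19) / 3

/-- `φ₁`, the inverse of the (strictly increasing) restriction of `R` to `[0, c]`. -/
def phi1 : ℝ → ℝ := Function.invFunOn R (Set.Icc 0 cpt)

/-- Eigenvalue counting function: total dimension of the eigenspaces of `−Δ_m`
with eigenvalue `≤ t`. -/
def evCount (m : ℕ) (t : ℝ) : ℕ :=
  Module.finrank ℝ ↥(⨆ lam ∈ Set.Iic t, eigensp m lam)

/-- `evSorted m k = λ_k(m)`, the `k`-th smallest eigenvalue (with multiplicity,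
`1 ≤ k ≤ 5^m`) of `−Δ_m` acting on functions on `K_m`. -/
def evSorted (m k : ℕ) : ℝ := sInf {t : ℝ | k ≤ evCount m t}

/-- The restriction of a function on the circle `ℝ/ℤ` to the level-`m` vertices. -/
def restr (u : AddCircle (1 : ℝ) → ℝ) (m : ℕ) : ZMod (Nm m) → ℝ := fun n =>
  u (((n.val : ℝ) / (Nm m : ℝ) : ℝ) : AddCircle (1 : ℝ))

/-- A continuous function on the circle is admissible if at every level its values
agree on identified pairs, so that its restrictions are functions on `K_m`. -/
def Admissible (u : AddCircle (1 : ℝ) → ℝ) : Prop :=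
  Continuous u ∧ ∀ m, 1 ≤ m → ∀ n : ZMod (Nm m), restr u m (partner m n) = restr u m n

/-- `u` is a `λ`-eigenfunction of `−Δ` on `K`: it is admissible, nonzero, and
`sup_n |15^m (−Δ_m u_m)(n) − λ u(n/N_m)| → 0` as `m → ∞`. -/
def IsEigenK (lam : ℝ) (u : AddCircle (1 : ℝ) → ℝ) : Prop :=
  Admissible u ∧ u ≠ 0 ∧
    ∀ ε : ℝ, 0 < ε → ∃ M : ℕ, ∀ m, M ≤ m → ∀ n : ZMod (Nm m),
      |(15 : ℝ) ^ m * lap m (restr u m) n - lam * restr u m n| < ε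

/-- The symmetry-type subspace `V_{ε₁,ε₂}` of functions on `K_m`. -/
def symSub (m : ℕ) (e1 e2 : ℝ) : Submodule ℝ (ZMod (Nm m) → ℝ) where
  carrier := {u | IsKFun m u ∧ (∀ n, u (-n) = e1 * u n) ∧
    (∀ n, u (((5 ^ m : ℕ) : ZMod (Nm m)) - n) = e2 * u n)}
  add_mem' := by
    rintro u v ⟨hu, hu1, hu2⟩ ⟨hv, hv1, hv2⟩
    refine ⟨fun n => by simp only [Pi.add_apply, hu n, hv n],
      fun n => by simp only [Pi.add_apply, hu1 n, hv1 n]; ring,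
      fun n => by simp only [Pi.add_apply, hu2 n, hv2 n]; ring⟩
  zero_mem' := ⟨fun _ => rfl, fun n => by simp, fun n => by simp⟩
  smul_mem' := by
    rintro c u ⟨hu, hu1, hu2⟩
    refine ⟨fun n => by simp only [Pi.smul_apply, hu n],
      fun n => by simp only [Pi.smul_apply, smul_eq_mul, hu1 n]; ring,
      fun n => by simp only [Pi.smul_apply, smul_eq_mul, hu2 n]; ring⟩

instance neZero_Nm (m : ℕ) : NeZero (Nm m) := ⟨by unfold Nm; positivity⟩

lemma Nm_succ (m : ℕ) : Nm (m + 1) = 5 * Nm m := by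
  unfold Nm; ring

lemma five_mul_natCast_Nm (m : ℕ) : (5 : ZMod (Nm (m + 1))) * (Nm m : ZMod (Nm (m + 1))) = 0 := by
  have h : ((5 * Nm m : ℕ) : ZMod (Nm (m + 1))) = 0 :=
    (ZMod.natCast_eq_zero_iff _ _).2 (Nm_succ m).dvd
  exact_mod_cast h

/-- Multiplication by five as a homomorphism from the level-`m` circle to the next level. -/
def embed (m : ℕ) : ZMod (Nm m) →+ ZMod (Nm (m + 1)) :=
  ZMod.lift (Nm m) ⟨(Int.castAddHom (ZMod (Nm (m + 1)))).comp (AddMonoidHom.mulLeft 5), by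
    simpa using five_mul_natCast_Nm m⟩

lemma embed_natCast (m a : ℕ) : embed m (a : ZMod (Nm m)) = ((5 * a : ℕ) : ZMod (Nm (m + 1))) := by
  rw [← Int.cast_natCast a, embed, ZMod.lift_coe]
  simp

lemma embed_eq (m : ℕ) (n : ZMod (Nm m)) :
    embed m n = ((5 * n.val : ℕ) : ZMod (Nm (m + 1))) := by
  rw [← embed_natCast, ZMod.natCast_zmod_val]

lemma embed_one (m : ℕ) : embed m 1 = 5 := by
  simpa using embed_natCast m 1

lemma down_apply (m : ℕ) (v : ZMod (Nm (m + 1)) → ℝ) (n : ZMod (Nm m)) :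
    down m v n = v (embed m n) := by
  rw [embed_eq]; rfl

lemma val_embed_add (m : ℕ) (n : ZMod (Nm m)) {r : ℕ} (hr : r < 5) :
    (embed m n + (r : ZMod (Nm (m + 1)))).val = 5 * n.val + r := by
  rw [embed_eq, ← Nat.cast_add, ZMod.val_natCast, Nat.mod_eq_of_lt]
  have := n.val_lt
  rw [Nm_succ]; omega

lemma val_embed (m : ℕ) (n : ZMod (Nm m)) : (embed m n).val = 5 * n.val := by
  simpa using val_embed_add m n (r := 0) (by norm_num)

lemma partner_embed (m : ℕ) (n : ZMod (Nm m)) :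
    partner (m + 1) (embed m n) = embed m (partner m n) := by
  have hw : (if (embed m n).val = 0 then Nm (m + 1) else (embed m n).val) =
      5 * (if n.val = 0 then Nm m else n.val) := by
    rw [val_embed, Nm_succ]; split_ifs <;> omega
  have h0 : (if n.val = 0 then Nm m else n.val) ≠ 0 := by
    split_ifs with h
    · exact NeZero.ne _
    · exact h
  unfold partner
  simp only [hw]
  generalize (if n.val = 0 then Nm m else n.val) = w at h0
  have hk : padicValNat 5 (5 * w) = padicValNat 5 w + 1 := by
    have : Fact (Nat.Prime 5) := ⟨by norm_num⟩
    rw [padicValNat.mul (by norm_num) h0, padicValNat_self, add_comm]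
  have hd : 5 * w / 5 ^ (padicValNat 5 w + 1) = w / 5 ^ padicValNat 5 w := by
    rw [pow_succ', Nat.mul_div_mul_left _ _ (by norm_num)]
  rw [hk, hd]
  split_ifs
  · rw [map_add, embed_natCast, pow_succ']
  · rw [map_sub, embed_natCast, pow_succ']

lemma partner_embed_add (m : ℕ) (n : ZMod (Nm m)) {r : ℕ} (hr : r < 5) (h0 : r ≠ 0) :
    partner (m + 1) (embed m n + (r : ZMod (Nm (m + 1)))) =
      if r = 1 ∨ r = 3 then embed m n + (r : ZMod (Nm (m + 1))) + 1
      else embed m n + (r : ZMod (Nm (m + 1))) - 1 := by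
  unfold partner
  have hne : 5 * n.val + r ≠ 0 := by omega
  have hk : padicValNat 5 (5 * n.val + r) = 0 :=
    padicValNat.eq_zero_of_not_dvd (by omega)
  have hmod : (5 * n.val + r) % 5 = r := by omega
  simp only [val_embed_add m n hr, if_neg hne, hk, pow_zero, Nat.div_one, hmod, Nat.cast_one]

lemma exists_embed_add (m : ℕ) (x : ZMod (Nm (m + 1))) :
    x = embed m ((x.val / 5 : ℕ) : ZMod (Nm m)) + ((x.val % 5 : ℕ) : ZMod (Nm (m + 1))) := by
  rw [embed_natCast, ← Nat.cast_add, Nat.div_add_mod, ZMod.natCast_zmod_val]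

section Cell

variable {m : ℕ} {lam' : ℝ} {v : ZMod (Nm (m + 1)) → ℝ}

lemma IsKFun.embed_add_two (hv : IsKFun (m + 1) v) (n : ZMod (Nm m)) :
    v (embed m n + 2) = v (embed m n + 1) := by
  have h := partner_embed_add m n (r := 1) (by norm_num) (by norm_num)
  have h' := hv (embed m n + 1)
  norm_num at h
  rw [h, add_assoc, one_add_one_eq_two] at h'
  exact h'

lemma IsKFun.embed_add_four (hv : IsKFun (m + 1) v) (n : ZMod (Nm m)) :
    v (embed m n + 4) = v (embed m n + 3) := by
  have h := partner_embed_add m n (r := 3) (by norm_num) (by norm_num)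
  have h' := hv (embed m n + 3)
  norm_num at h
  rw [h, add_assoc, show (3 : ZMod (Nm (m + 1))) + 1 = 4 by norm_num] at h'
  exact h'

lemma IsEigen.cell_left (hv : IsEigen (m + 1) lam' v) (n : ZMod (Nm m)) :
    (2 - lam') * v (embed m n + 1) = v (embed m n) + v (embed m n + 3) := by
  have h := partner_embed_add m n (r := 1) (by norm_num) (by norm_num)
  have he := hv.2.2 (embed m n + 1)
  norm_num at h
  have e1 : embed m n + 1 + 1 = embed m n + 2 := by ring
  have e2 : embed m n + 2 + 1 = embed m n + 3 := by ring
  have e3 : embed m n + 2 - 1 = embed m n + 1 := by ring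
  have e4 : embed m n + 1 - 1 = embed m n := by ring
  rw [lap, h, e1, e2, e3, e4, hv.1.embed_add_two] at he
  linarith

lemma IsEigen.cell_right (hv : IsEigen (m + 1) lam' v) (n : ZMod (Nm m)) :
    (2 - lam') * v (embed m n + 3) = v (embed m n + 1) + v (embed m (n + 1)) := by
  have h := partner_embed_add m n (r := 3) (by norm_num) (by norm_num)
  have he := hv.2.2 (embed m n + 3)
  norm_num at h
  have e1 : embed m n + 3 + 1 = embed m n + 4 := by ring
  have e2 : embed m n + 4 + 1 = embed m (n + 1) := by rw [map_add, embed_one]; ring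
  have e3 : embed m n + 4 - 1 = embed m n + 3 := by ring
  have e4 : embed m n + 3 - 1 = embed m n + 2 := by ring
  rw [lap, h, e1, e2, e3, e4, hv.1.embed_add_two, hv.1.embed_add_four] at he
  linarith

lemma IsEigen.mul_embed_add_one (hv : IsEigen (m + 1) lam' v) (n : ZMod (Nm m)) :
    v (embed m n + 1) * ((1 - lam') * (3 - lam')) =
      (2 - lam') * v (embed m n) + v (embed m (n + 1)) := by
  linear_combination (2 - lam') * hv.cell_left n + hv.cell_right n

lemma IsEigen.mul_embed_add_three (hv : IsEigen (m + 1) lam' v) (n : ZMod (Nm m)) :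
    v (embed m n + 3) * ((1 - lam') * (3 - lam')) =
      v (embed m n) + (2 - lam') * v (embed m (n + 1)) := by
  linear_combination hv.cell_left n + (2 - lam') * hv.cell_right n

lemma IsEigen.eq_extFun (hv : IsEigen (m + 1) lam' v) (h1 : lam' ≠ 1) (h3 : lam' ≠ 3) :
    v = extFun m lam' (down m v) := by
  have hD : (1 - lam') * (3 - lam') ≠ 0 :=
    mul_ne_zero (sub_ne_zero.2 h1.symm) (sub_ne_zero.2 h3.symm)
  funext x
  have hx := exists_embed_add m x
  have hlt : x.val % 5 < 5 := Nat.mod_lt _ (by norm_num)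
  simp only [extFun, down_apply]
  generalize ((x.val / 5 : ℕ) : ZMod (Nm m)) = n at *
  generalize x.val % 5 = r at *
  subst hx
  have hl := (eq_div_iff hD).2 (hv.mul_embed_add_one n)
  have hr := (eq_div_iff hD).2 (hv.mul_embed_add_three n)
  interval_cases r
  · simp
  · simpa using hl
  · simpa [hv.1.embed_add_two] using hl
  · simpa using hr
  · simpa [hv.1.embed_add_four] using hr

lemma IsEigen.lap_down (hv : IsEigen (m + 1) lam' v) (n : ZMod (Nm m)) :
    lap m (down m v) n = R lam' * down m v n := by
  have he := hv.2.2 (embed m n)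
  have hprev : ∀ k : ZMod (Nm m), v (embed m k - 1) = v (embed m (k - 1) + 3) := fun k => by
    rw [← hv.1.embed_add_four, map_sub, embed_one]
    congr 1; ring
  have hp : v (embed m (partner m n)) = v (embed m n) := by
    rw [← partner_embed, hv.1]
  have a1 := hv.mul_embed_add_one n
  have a2 := hv.mul_embed_add_three (n - 1)
  have a3 := hv.mul_embed_add_one (partner m n)
  have a4 := hv.mul_embed_add_three (partner m n - 1)
  rw [sub_add_cancel] at a2 a4
  rw [hp] at a3 a4
  rw [lap, partner_embed, hprev, hprev] at he
  simp only [lap, down_apply, R]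
  linear_combination ((1 - lam') * (3 - lam')) * he + a1 + a2 + a3 + a4

end Cell

/-- If `v` is a `λ'`-eigenfunction of `−Δ_{m+1}` with `λ' ∉ {1,3}`,
then `u(n) = v(5n)` is a nonzero `R(λ')`-eigenfunction of `−Δ_m`, and `v` is the
`λ'`-extension of `u`. -/
theorem eigenfunction_restricts (m : ℕ) (hm : 1 ≤ m) (lam' : ℝ)
    (v : ZMod (Nm (m + 1)) → ℝ) (hv : IsEigen (m + 1) lam' v)
    (h1 : lam' ≠ 1) (h3 : lam' ≠ 3) :
    IsEigen m (R lam') (down m v) ∧ v = extFun m lam' (down m v) := by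
  have hext := hv.eq_extFun h1 h3
  refine ⟨⟨fun n => ?_, fun h0 => hv.2.1 ?_, hv.lap_down⟩, hext⟩
  · rw [down_apply, down_apply, ← partner_embed, hv.1]
  · rw [hext, h0]
    funext x
    simp [extFun]

end VNLE
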